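/- Let D ≥ 𝒟 and let γ be a terminal configuration of Algo_HC(D). Then every vertex p satisfies d_p = dist(p, r) in γ. -/

import Mathlib

open SimpleGraph

structure Config (V : Type*) where
  d : V → ℕ
  par : V → V

/-- `Min_d(p)`: the minimum of the `d`-values of the neighbors of `p`. -/
noncomputable def minD {V : Type*} (G : SimpleGraph V) (γ : Config V) (p : V) : ℕ :=
  sInf (γ.d '' {q | G.Adj p q})

def dOk {V : Type*} (G : SimpleGraph V) (γ : Config V) (p : V) : Prop :=
  γ.d p = minD G γ p + 1

def parOk {V : Type*} (γ : Config V) (p : V) : Prop :=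
  γ.d p = γ.d (γ.par p) + 1

/-- A valid configuration of `Algo_U`. -/
def ValidU {V : Type*} (G : SimpleGraph V) (r : V) (γ : Config V) : Prop :=
  γ.d r = 0 ∧ ∀ p, p ≠ r → G.Adj p (γ.par p)

/-- A valid configuration of `Algo_B(D)` / `Algo_HC(D)`: non-root `d`-values lie in `{1,…,D}`. -/
def ValidB {V : Type*} (G : SimpleGraph V) (r : V) (D : ℕ) (γ : Config V) : Prop :=
  γ.d r = 0 ∧ ∀ p, p ≠ r → G.Adj p (γ.par p) ∧ 1 ≤ γ.d p ∧ γ.d p ≤ D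

def Legitimate {V : Type*} (G : SimpleGraph V) (r : V) (γ : Config V) : Prop :=
  (∀ p, γ.d p = G.dist p r) ∧ ∀ p, p ≠ r → γ.d p = γ.d (γ.par p) + 1

/-- Terminal configurations of `Algo_U`. -/
def TerminalU {V : Type*} (G : SimpleGraph V) (r : V) (γ : Config V) : Prop :=
  ∀ p, p ≠ r → dOk G γ p ∧ parOk γ p

/-- Terminal configurations of `Algo_B(D)`. -/
def TerminalB {V : Type*} (G : SimpleGraph V) (r : V) (D : ℕ) (γ : Config V) : Prop :=
  ∀ p, p ≠ r →
    (minD G γ p < D → dOk G γ p ∧ parOk γ p) ∧ (minD G γ p = D → γ.d p = D)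

/-- Terminal configurations of `Algo_HC(D)`. -/
def TerminalHC {V : Type*} (G : SimpleGraph V) (r : V) (D : ℕ) (γ : Config V) : Prop :=
  ∀ p, p ≠ r →
    (parOk γ p ∨ D ≤ γ.d (γ.par p)) ∧ γ.d (γ.par p) ≤ minD G γ p

theorem minD_le_of_adj {V : Type*} {G : SimpleGraph V} {γ : Config V} {p q : V}
    (h : G.Adj p q) : minD G γ p ≤ γ.d q :=
  Nat.sInf_le ⟨q, h, rfl⟩

theorem exists_adj_dist_add_one_eq {V : Type*} {G : SimpleGraph V} (hconn : G.Connected)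
    {p r : V} (hp : p ≠ r) : ∃ q, G.Adj p q ∧ G.dist q r + 1 = G.dist p r := by
  obtain ⟨w, hw⟩ := hconn.exists_walk_length_eq_dist p r
  cases w with
  | nil => exact absurd rfl hp
  | @cons _ q _ h w =>
    refine ⟨q, h, ?_⟩
    have h₁ := SimpleGraph.dist_le w
    have h₂ := hconn.dist_triangle (u := p) (v := q) (w := r)
    have h₃ := SimpleGraph.dist_eq_one_iff_adj.mpr h
    rw [SimpleGraph.Walk.length_cons] at hw
    omega

/-- In a terminal configuration, the bound `d q ≤ dist(q, r)` on the vertices `q` one step closer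
to the root than `p` forces `parOk p` and passes to `p`. -/
theorem TerminalHC.parOk_and_d_le {V : Type*} {G : SimpleGraph V} {r : V} {D : ℕ} {γ : Config V}
    (hconn : G.Connected) (hterm : TerminalHC G r D γ) {p : V} (hp : p ≠ r)
    (hD : G.dist p r ≤ D)
    (hle : ∀ q, G.dist q r + 1 = G.dist p r → γ.d q ≤ G.dist q r) :
    parOk γ p ∧ γ.d p ≤ G.dist p r := by
  obtain ⟨q, hq, hdist⟩ := exists_adj_dist_add_one_eq hconn hp
  obtain ⟨hpar, hmin⟩ := hterm p hp
  have h₁ := minD_le_of_adj (γ := γ) hq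
  have h₂ := hle q hdist
  have hok : parOk γ p := hpar.resolve_right (by omega)
  refine ⟨hok, ?_⟩
  rw [parOk] at hok
  omega

theorem TerminalHC.d_le_dist {V : Type*} {G : SimpleGraph V} {r : V} {D : ℕ} {γ : Config V}
    (hconn : G.Connected) (hD : ∀ p, G.dist p r ≤ D) (hr : γ.d r = 0)
    (hterm : TerminalHC G r D γ) (p : V) : γ.d p ≤ G.dist p r := by
  induction hk : G.dist p r using Nat.strong_induction_on generalizing p with
  | _ k ih =>
    by_cases hp : p = r
    · simp [hp, hr]
    · rw [← hk]
      exact (hterm.parOk_and_d_le hconn hp (hD p) fun q hq => ih _ (by omega) q rfl).2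

theorem dist_le_d_of_parOk {V : Type*} {G : SimpleGraph V} {r : V} {γ : Config V}
    (hconn : G.Connected) (hpar : ∀ p, p ≠ r → G.Adj p (γ.par p) ∧ parOk γ p) (p : V) :
    G.dist p r ≤ γ.d p := by
  induction hk : γ.d p using Nat.strong_induction_on generalizing p with
  | _ k ih =>
    by_cases hp : p = r
    · simp [hp]
    · obtain ⟨hadj, hok⟩ := hpar p hp
      rw [parOk] at hok
      have h₁ := ih _ (by omega) (γ.par p) rfl
      have h₂ := hconn.dist_triangle (u := p) (v := γ.par p) (w := r)
      have h₃ := SimpleGraph.dist_eq_one_iff_adj.mpr hadj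
      omega

/-- Let `D ≥ 𝒟` and let `γ` be a terminal configuration of `Algo_HC(D)`. Then every
vertex `p` satisfies `d p = dist(p, r)` in `γ`. -/
theorem terminalHC_d_eq_dist {V : Type*} [Fintype V]
    (G : SimpleGraph V) (hconn : G.Connected) (r : V) (D : ℕ) (hD : G.diam ≤ D)
    (γ : Config V) (hvalid : ValidB G r D γ) (hterm : TerminalHC G r D γ) :
    ∀ p, γ.d p = G.dist p r := by
  obtain ⟨hr, hv⟩ := hvalid
  have : Nonempty V := ⟨r⟩
  have hdist : ∀ p, G.dist p r ≤ D := fun p =>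
    (SimpleGraph.dist_le_diam (SimpleGraph.connected_iff_ediam_ne_top.mp hconn)).trans hD
  have hle := hterm.d_le_dist hconn hdist hr
  exact fun p => (hle p).antisymm <| dist_le_d_of_parOk hconn (fun q hq =>
    ⟨(hv q hq).1, (hterm.parOk_and_d_le hconn hq (hdist q) fun q' _ => hle q').1⟩) p
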